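/- Let F be a field and let n, k be integers with n ≥ k + 2, k ≥ 3, |F| > k, and n + k even. If φ, ψ : M_{n×k}(F) → M_{n×k}(F) are maps such that det_{n,k}(X + λY) = det_{n,k}(φ(X) + λψ(Y)) for all X, Y ∈ M_{n×k}(F) and λ ∈ F, then there exist matrices A ∈ M_{n×n}(F) and B ∈ M_{k×k}(F) such that det_{n,k}(A[·|i_1,…,i_k]) · det(B) = (-1)^{i_1+…+i_k-1-…-k} for every increasing sequence 1 ≤ i_1 < … < i_k ≤ n (where A[·|i_1,…,i_k] denotes the n×k submatrix of A formed by columns i_1,…,i_k), and φ(X) = ψ(X) = A·X·B for all X ∈ M_{n×k}(F). -/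

import Mathlib

open scoped Classical

noncomputable section

/-- The Cullis determinant of an `n × k` matrix: the alternating sum
`∑ (-1)^{i₁+⋯+i_k - 1 - ⋯ - k} det X[i₁,…,i_k]` of its maximal minors
(indices `i₁ < ⋯ < i_k` written `1`-based; note `(-1)^{a-b} = (-1)^{a+b}`). -/
def cullisDet {R : Type*} [CommRing R] {n k : ℕ} (X : Matrix (Fin n) (Fin k) R) : R :=
  ∑ f : Fin k → Fin n,
    if StrictMono f then
      (-1 : R) ^ ((∑ t : Fin k, ((f t : ℕ) + 1)) + (∑ t : Fin k, ((t : ℕ) + 1))) *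
        Matrix.det (Matrix.of fun i j : Fin k => X (f i) j)
    else 0

section

variable {F : Type*} [Field F]

/-- The sign `(-1)^{i₁+⋯+i_k - 1 - ⋯ - k}` attached to a choice of rows. -/
def cullisSign (F : Type*) [Field F] {n k : ℕ} (f : Fin k → Fin n) : F :=
  (-1) ^ ((∑ t : Fin k, ((f t : ℕ) + 1)) + (∑ t : Fin k, ((t : ℕ) + 1)))

/-- The Cullis determinant as an alternating form in the columns. -/
def cullisForm (F : Type*) [Field F] (n k : ℕ) : (Fin n → F) [⋀^Fin k]→ₗ[F] F :=
  ∑ f : Fin k → Fin n, if StrictMono f then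
    cullisSign F f •
      (Matrix.detRowAlternating (R := F) (n := Fin k)).compLinearMap (LinearMap.funLeft F F f)
  else 0

theorem cullisForm_apply {n k : ℕ} (x : Fin k → Fin n → F) :
    cullisForm F n k x = ∑ f : Fin k → Fin n, if StrictMono f then
      cullisSign F f * Matrix.det (Matrix.of fun i j : Fin k => x j (f i)) else 0 := by
  let evalHom : ((Fin n → F) [⋀^Fin k]→ₗ[F] F) →+ F :=
    { toFun := fun w => w x, map_zero' := rfl, map_add' := fun _ _ => rfl }
  change evalHom (cullisForm F n k) = _
  rw [cullisForm, map_sum]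
  refine Finset.sum_congr rfl fun f _ => ?_
  split_ifs
  · rw [← Matrix.det_transpose]
    rfl
  · rfl

theorem cullisDet_eq_cullisForm {n k : ℕ} (X : Matrix (Fin n) (Fin k) F) :
    cullisDet X = cullisForm F n k (fun j i => X i j) := by
  rw [cullisForm_apply]
  rfl

theorem exists_insertion_position {n k : ℕ} (i : Fin (n + 1)) (g : Fin k → Fin n)
    (hg : StrictMono g) :
    ∃ p : Fin (k + 1), ∀ b, b.castSucc < p ↔ (g b).castSucc < i := by
  by_cases hex : ∃ b, i ≤ (g b).castSucc
  · obtain ⟨b, hb, hmin⟩ := WellFounded.has_min wellFounded_lt {b | i ≤ (g b).castSucc} hex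
    refine ⟨b.castSucc, fun c => ?_⟩
    rw [Fin.castSucc_lt_castSucc_iff]
    constructor
    · intro hc
      by_contra hcon
      exact hmin c (not_lt.mp hcon) hc
    · intro hc
      by_contra hcon
      have : g b ≤ g c := hg.monotone (not_lt.mp hcon)
      exact absurd (hc.trans_le hb) (not_lt.mpr (Fin.castSucc_le_castSucc_iff.mpr this))
  · push Not at hex
    exact ⟨Fin.last k, fun b => by simp [hex b, Fin.castSucc_lt_last]⟩

theorem strictMono_insertNth_of_position {n k : ℕ} (i : Fin (n + 1)) (g : Fin k → Fin n)
    (hg : StrictMono g) (p : Fin (k + 1)) (hp : ∀ b, b.castSucc < p ↔ (g b).castSucc < i) :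
    StrictMono (p.insertNth i (fun b => i.succAbove (g b)) : Fin (k + 1) → Fin (n + 1)) := by
  refine (Fin.strictMono_insertNth_iff p i _).mpr
    ⟨(Fin.strictMono_succAbove i).comp hg, fun b hb => ?_, fun b hb => ?_⟩
  · exact (Fin.succAbove_lt_iff_castSucc_lt _ _).mpr ((hp b).mp hb)
  · exact (Fin.lt_succAbove_iff_le_castSucc _ _).mpr
      (not_lt.mp fun h => absurd ((hp b).mpr h) (not_lt.mpr hb))

theorem cullisSign_insertNth {n k : ℕ} (i : Fin (n + 1)) (g : Fin k → Fin n)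
    (p : Fin (k + 1)) (hp : ∀ b, b.castSucc < p ↔ (g b).castSucc < i) :
    cullisSign F (p.insertNth i (fun b => i.succAbove (g b)) : Fin (k + 1) → Fin (n + 1))
      * (-1) ^ (p : ℕ) = (-1) ^ (i : ℕ) * cullisSign F g := by
  have key : ∀ b : Fin k, ((i.succAbove (g b) : ℕ) + 1) + ((p.succAbove b : ℕ) + 1)
      = ((g b : ℕ) + 1) + ((b : ℕ) + 1) + 2 * (if b.castSucc < p then 0 else 1) := by
    intro b
    by_cases hb : b.castSucc < p
    · rw [Fin.succAbove_of_castSucc_lt _ _ hb, Fin.succAbove_of_castSucc_lt _ _ ((hp b).mp hb)]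
      simp [hb]
    · have hb' : ¬ (g b).castSucc < i := fun h => hb ((hp b).mpr h)
      rw [Fin.succAbove_of_le_castSucc _ _ (not_lt.mp hb),
        Fin.succAbove_of_le_castSucc _ _ (not_lt.mp hb')]
      simp [hb]
      ring
  unfold cullisSign
  rw [Fin.sum_univ_succAbove _ p, Fin.sum_univ_succAbove _ p]
  simp only [Fin.insertNth_apply_same, Fin.insertNth_apply_succAbove]
  rw [← pow_add, ← pow_add]
  have hsum := Finset.sum_congr (rfl : (Finset.univ : Finset (Fin k)) = Finset.univ)
    (fun b _ => key b)
  rw [Finset.sum_add_distrib, Finset.sum_add_distrib (g := fun b => 2 * _),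
    Finset.sum_add_distrib (f := fun b => (g b : ℕ) + 1), ← Finset.mul_sum] at hsum
  set S := ∑ b : Fin k, (if b.castSucc < p then 0 else 1)
  have hexp : ∀ a b c : ℕ, a = b + 2 * c → (-1 : F) ^ a = (-1) ^ b := by
    rintro a b c rfl
    rw [pow_add, pow_mul]
    simp
  refine hexp _ _ (S + p + 1) ?_
  omega

/-- Plugging a standard basis vector into the Cullis form deletes the corresponding row. -/
theorem cullisForm_cons_single {n k : ℕ} (i : Fin (n + 1)) (y : Fin k → Fin (n + 1) → F) :
    cullisForm F (n + 1) (k + 1) (Fin.cons (Pi.single i 1) y)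
      = (-1) ^ (i : ℕ) * cullisForm F n k (fun j => y j ∘ i.succAbove) := by
  have hL : cullisForm F (n + 1) (k + 1) (Fin.cons (Pi.single i 1) y)
      = ∑ q : (Fin (k + 1) → Fin (n + 1)) × Fin (k + 1) with StrictMono q.1 ∧ q.1 q.2 = i,
        cullisSign F q.1 * (-1) ^ (q.2 : ℕ) *
          Matrix.det (Matrix.of fun a b : Fin k => y b (q.1 (q.2.succAbove a))) := by
    rw [cullisForm_apply, Finset.sum_filter, Fintype.sum_prod_type]
    refine Finset.sum_congr rfl fun f _ => ?_
    by_cases hf : StrictMono f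
    · rw [if_pos hf, Matrix.det_succ_column_zero, Finset.mul_sum]
      refine Finset.sum_congr rfl fun p _ => ?_
      by_cases hp : f p = i
      · simp only [hf, hp, and_self, if_true, Matrix.of_apply, Fin.cons_zero, Pi.single_eq_same,
          mul_one, mul_assoc]
        rfl
      · simp [hp]
    · simp [hf]
  rw [hL, cullisForm_apply, Finset.mul_sum, ← Finset.sum_filter_add_sum_filter_not _ StrictMono
    (fun g : Fin k → Fin n => (-1 : F) ^ (i : ℕ) * _)]
  rw [Finset.sum_eq_zero (s := Finset.univ.filter fun g : Fin k → Fin n => ¬ StrictMono g)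
    (fun g hg => by rw [if_neg (Finset.mem_filter.mp hg).2, mul_zero]), add_zero]
  symm
  have hpos := fun g : Fin k → Fin n => fun hg => exists_insertion_position i g hg
  choose pos hpos using hpos
  refine Finset.sum_bij (fun g hg => ((pos g (Finset.mem_filter.mp hg).2).insertNth i
    (fun b => i.succAbove (g b)), pos g (Finset.mem_filter.mp hg).2)) ?_ ?_ ?_ ?_
  · intro g hg
    have hg' := (Finset.mem_filter.mp hg).2
    refine Finset.mem_filter.mpr ⟨Finset.mem_univ _, ?_, ?_⟩
    · exact strictMono_insertNth_of_position i g hg' _ (hpos g hg')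
    · simp
  · intro g hg g' hg' heq
    have h2 := (Prod.ext_iff.mp heq).2
    have h1 := (Prod.ext_iff.mp heq).1
    simp only at h1 h2
    rw [h2] at h1
    funext b
    have := congrFun h1 ((pos g' (Finset.mem_filter.mp hg').2).succAbove b)
    simpa using this
  · rintro ⟨f, p⟩ hq
    obtain ⟨hf, hfp⟩ := (Finset.mem_filter.mp hq).2
    simp only at hf hfp
    have hex : ∀ b : Fin k, ∃ c, i.succAbove c = f (p.succAbove b) := fun b =>
      Fin.exists_succAbove_eq fun h => Fin.succAbove_ne p b (hf.injective (h.trans hfp.symm))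
    choose g hg using hex
    have hgm : StrictMono g := fun a b hab => by
      rw [← (Fin.strictMono_succAbove i).lt_iff_lt, hg, hg]
      exact hf (Fin.strictMono_succAbove p hab)
    have hiff : ∀ b, b.castSucc < p ↔ (g b).castSucc < i := fun b => by
      rw [← Fin.succAbove_lt_iff_castSucc_lt, ← Fin.succAbove_lt_iff_castSucc_lt, hg, ← hfp,
        hf.lt_iff_lt]
    have hpp : pos g hgm = p := by
      have hall : ∀ b : Fin k, b.castSucc < pos g hgm ↔ b.castSucc < p := fun b =>
        (hpos g hgm b).trans (hiff b).symm
      rcases lt_trichotomy (pos g hgm) p with h | h | h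
      · have := (hall ⟨pos g hgm, by omega⟩).mpr h
        exact absurd this (lt_irrefl _)
      · exact h
      · have := (hall ⟨p, by omega⟩).mp h
        exact absurd this (lt_irrefl _)
    refine ⟨g, Finset.mem_filter.mpr ⟨Finset.mem_univ _, hgm⟩, ?_⟩
    refine Prod.ext ?_ hpp
    simp only [hpp]
    funext a
    rcases Fin.eq_self_or_eq_succAbove p a with rfl | ⟨a, rfl⟩
    · simp [hfp]
    · simp [hg]
  · intro g hg
    have hg' := (Finset.mem_filter.mp hg).2
    rw [if_pos hg']
    simp only [Fin.insertNth_apply_succAbove]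
    rw [cullisSign_insertNth i g _ (hpos g hg')]
    rw [mul_assoc]
    rfl

/-- `u` lies in the radical of the Cullis form. -/
def InRadical (n k : ℕ) (u : Fin n → F) : Prop :=
  ∀ (x : Fin k → Fin n → F) (j : Fin k), x j = u → cullisForm F n k x = 0

/-- The bivector `u ∧ v` is annihilated by contraction with the Cullis form. -/
def AnnihilatesPair (n k : ℕ) (u v : Fin n → F) : Prop :=
  ∀ (x : Fin k → Fin n → F) (i j : Fin k), i ≠ j → x i = u → x j = v → cullisForm F n k x = 0

/-- All `2 × 2` minors of the pair `(u, v)` vanish. -/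
def Proportional {n : ℕ} (u v : Fin n → F) : Prop :=
  ∀ p q, u p * v q = u q * v p

/-- The alternating sum of the coordinates, which is the Cullis form for `k = 1`. -/
def altSum (n : ℕ) (u : Fin n → F) : F := ∑ a : Fin n, (-1) ^ (a : ℕ) * u a

theorem altSum_add {n : ℕ} (u v : Fin n → F) : altSum n (u + v) = altSum n u + altSum n v := by
  simp [altSum, mul_add, Finset.sum_add_distrib]

theorem altSum_smul {n : ℕ} (c : F) (u : Fin n → F) : altSum n (c • u) = c * altSum n u := by
  simp only [altSum, Finset.mul_sum, Pi.smul_apply, smul_eq_mul]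
  exact Finset.sum_congr rfl fun a _ => by ring

theorem altSum_single {n : ℕ} (i : Fin n) (c : F) :
    altSum n (Pi.single i c) = (-1) ^ (i : ℕ) * c := by
  rw [altSum, Finset.sum_eq_single i]
  · simp
  · intro b _ hb
    simp [hb]
  · simp

theorem altSum_const {n : ℕ} (hn : Odd n) (c : F) : altSum n (fun _ => c) = c := by
  rw [altSum, ← Finset.sum_mul, Fin.sum_univ_eq_sum_range (fun a => (-1 : F) ^ a),
    neg_one_geom_sum, if_neg (Nat.not_even_iff_odd.mpr hn), one_mul]

theorem cullisForm_one {n : ℕ} (x : Fin 1 → Fin n → F) :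
    cullisForm F n 1 x = altSum n (x 0) := by
  rw [cullisForm_apply, altSum, ← (Equiv.funUnique (Fin 1) (Fin n)).symm.sum_comp]
  refine Finset.sum_congr rfl fun a _ => ?_
  rw [if_pos (Subsingleton.strictMono _)]
  simp [cullisSign, pow_succ]

theorem InRadical.comp_succAbove {n k : ℕ} {u : Fin (n + 1) → F}
    (h : InRadical (n + 1) (k + 1) u) (i : Fin (n + 1)) :
    InRadical n k (u ∘ i.succAbove) := by
  intro x j hx
  have h1 := h (Fin.cons (Pi.single i 1) (fun l => if l = j then u else
    (i.insertNth 0 (x l) : Fin (n + 1) → F))) j.succ (by simp)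
  rw [cullisForm_cons_single] at h1
  have h2 := (mul_eq_zero.mp h1).resolve_left (pow_ne_zero _ (neg_ne_zero.mpr one_ne_zero))
  convert h2 using 2
  funext l
  by_cases hl : l = j
  · subst hl
    simp [hx]
  · funext a
    simp [hl]

theorem AnnihilatesPair.comp_succAbove {n k : ℕ} {u v : Fin (n + 1) → F}
    (h : AnnihilatesPair (n + 1) (k + 1) u v) (i : Fin (n + 1)) :
    AnnihilatesPair n k (u ∘ i.succAbove) (v ∘ i.succAbove) := by
  intro x j j' hj hx hx'
  have h1 := h (Fin.cons (Pi.single i 1) (fun l => if l = j then u else if l = j' then v else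
    (i.insertNth 0 (x l) : Fin (n + 1) → F))) j.succ j'.succ
    (fun e => hj (Fin.succ_injective _ e)) (by simp) (by simp [hj.symm])
  rw [cullisForm_cons_single] at h1
  have h2 := (mul_eq_zero.mp h1).resolve_left (pow_ne_zero _ (neg_ne_zero.mpr one_ne_zero))
  convert h2 using 2
  funext l
  by_cases hl : l = j
  · subst hl
    simp [hx]
  · by_cases hl' : l = j'
    · subst hl'
      simp [hx', hl]
    · funext a
      simp [hl, hl']

theorem AnnihilatesPair.inRadical_comp_succAbove {n k : ℕ} {v : Fin (n + 1) → F}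
    {i : Fin (n + 1)} (h : AnnihilatesPair (n + 1) (k + 1) (Pi.single i 1) v) :
    InRadical n k (v ∘ i.succAbove) := by
  intro x j hx
  have h1 := h (Fin.cons (Pi.single i 1) (fun l => if l = j then v else
    (i.insertNth 0 (x l) : Fin (n + 1) → F))) 0 j.succ (Fin.succ_ne_zero j).symm (by simp)
    (by simp)
  rw [cullisForm_cons_single] at h1
  have h2 := (mul_eq_zero.mp h1).resolve_left (pow_ne_zero _ (neg_ne_zero.mpr one_ne_zero))
  convert h2 using 2
  funext l
  by_cases hl : l = j
  · subst hl
    simp [hx]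
  · funext a
    simp [hl]

theorem AnnihilatesPair.symm {n k : ℕ} {u v : Fin n → F} (h : AnnihilatesPair n k u v) :
    AnnihilatesPair n k v u := fun x i j hij hi hj => h x j i hij.symm hj hi

theorem AnnihilatesPair.smul_add_smul {n k : ℕ} {u v : Fin n → F}
    (h : AnnihilatesPair n k u v) (a b : F) : AnnihilatesPair n k (a • u + b • v) v := by
  intro x i j hij hi hj
  have hx : x = Function.update x i (a • u + b • v) := by rw [← hi, Function.update_eq_self]
  rw [hx, AlternatingMap.map_update_add, AlternatingMap.map_update_smul,
    AlternatingMap.map_update_smul, h _ i j hij (by simp) (by simp [hij.symm, hj]),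
    AlternatingMap.map_eq_zero_of_eq _ (Function.update x i v) (i := i) (j := j)
      (by simp [hij.symm, hj]) hij]
  simp

/-- Deleting one of two adjacent entries gives vectors that differ in one place only. -/
theorem comp_castSucc_succAbove {m : ℕ} (u : Fin (m + 1) → F) (i : Fin m) :
    u ∘ i.castSucc.succAbove
      = u ∘ i.succ.succAbove + Pi.single i (u i.succ - u i.castSucc) := by
  funext a
  simp only [Function.comp_apply, Pi.add_apply]
  rcases lt_trichotomy a i with h | rfl | h
  · rw [Pi.single_eq_of_ne h.ne, add_zero]
    rw [Fin.succAbove_of_castSucc_lt _ _ (Fin.castSucc_lt_castSucc_iff.mpr h),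
      Fin.succAbove_of_castSucc_lt _ _ (by rw [Fin.lt_def] at *; simp; omega)]
  · rw [Pi.single_eq_same, Fin.succAbove_castSucc_self, Fin.succAbove_succ_self]
    ring
  · rw [Pi.single_eq_of_ne h.ne', add_zero]
    rw [Fin.succAbove_of_le_castSucc _ _ (Fin.castSucc_le_castSucc_iff.mpr h.le),
      Fin.succAbove_of_le_castSucc _ _ (by rw [Fin.lt_def] at h; rw [Fin.le_def]; simp; omega)]

theorem eq_of_adjacent_eq {α : Type*} {m : ℕ} (u : Fin (m + 1) → α)
    (h : ∀ i : Fin m, u i.succ = u i.castSucc) : u = fun _ => u 0 := by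
  funext a
  induction a using Fin.induction with
  | zero => rfl
  | succ i ih => rw [h i, ih]

theorem eq_zero_of_altSum_comp_succAbove {m : ℕ} (hm : Odd m) (u : Fin (m + 1) → F)
    (h : ∀ i : Fin (m + 1), altSum m (u ∘ i.succAbove) = 0) : u = 0 := by
  have hc : u = fun _ => u 0 := by
    refine eq_of_adjacent_eq u fun i => ?_
    have h1 := h i.castSucc
    rw [comp_castSucc_succAbove, altSum_add, h, zero_add, altSum_single] at h1
    exact sub_eq_zero.mp
      ((mul_eq_zero.mp h1).resolve_left (pow_ne_zero _ (neg_ne_zero.mpr one_ne_zero)))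
  have h0 := h 0
  rw [hc] at h0 ⊢
  have h2 : altSum m ((fun _ => u 0) ∘ (0 : Fin (m + 1)).succAbove) = u 0 := altSum_const hm _
  rw [h2] at h0
  funext a
  simpa using h0

theorem InRadical.eq_zero_of_two {n : ℕ} (hn : Even n) {u : Fin n → F}
    (h : InRadical n 2 u) : u = 0 := by
  rcases n with _ | m
  · exact Subsingleton.elim _ _
  · refine eq_zero_of_altSum_comp_succAbove (by grind) u fun i => ?_
    rw [← cullisForm_one (fun _ => u ∘ i.succAbove)]
    exact h.comp_succAbove i _ 0 rfl

theorem InRadical.eq_zero {n k : ℕ} (hk : 2 ≤ k) (hkn : k ≤ n) (hnk : Even (n + k))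
    {u : Fin n → F} (h : InRadical n k u) : u = 0 := by
  induction k, hk using Nat.le_induction generalizing n with
  | base => exact h.eq_zero_of_two (by grind)
  | succ k hk ih =>
    obtain ⟨m, rfl⟩ : ∃ m, n = m + 1 := ⟨n - 1, by omega⟩
    have key : ∀ i, u ∘ Fin.succAbove i = 0 := fun i =>
      ih (by omega) (by grind) (h.comp_succAbove i)
    funext a
    obtain ⟨m, rfl⟩ : ∃ l, m = l + 1 := ⟨m - 1, by omega⟩
    obtain ⟨i, hi⟩ := exists_ne a
    obtain ⟨z, hz⟩ := Fin.exists_succAbove_eq hi.symm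
    rw [← hz]
    exact congrFun (key i) z

theorem altSum_eq_delete_adjacent {m : ℕ} (v : Fin (m + 2) → F) (i : Fin (m + 1)) :
    altSum (m + 2) v = altSum m ((v ∘ i.succ.succAbove) ∘ i.succAbove)
      - (-1) ^ (i : ℕ) * (v i.succ - v i.castSucc) := by
  unfold altSum
  rw [Fin.sum_univ_succAbove _ i.succ, Fin.sum_univ_succAbove _ i, Fin.succAbove_succ_self]
  have : ∀ c : Fin m, (-1 : F) ^ ((i.succ.succAbove (i.succAbove c) : Fin (m + 2)) : ℕ)
      = (-1) ^ (c : ℕ) := by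
    intro c
    rcases lt_or_ge c.castSucc i with h | h
    · rw [Fin.succAbove_of_castSucc_lt i _ h, Fin.succAbove_of_castSucc_lt]
      · simp
      · rw [Fin.lt_def] at *
        simp at *
        omega
    · rw [Fin.succAbove_of_le_castSucc i _ h, Fin.succAbove_of_le_castSucc]
      · simp [pow_succ]
      · rw [Fin.le_def] at *
        simp at *
        omega
  simp only [this, Function.comp_apply, Fin.val_succ, Fin.val_castSucc, pow_succ]
  ring

theorem cullisForm_two_single_left {m : ℕ} (i : Fin (m + 1)) (y : Fin (m + 1) → F) :
    cullisForm F (m + 1) 2 ![Pi.single i 1, y] = (-1) ^ (i : ℕ) * altSum m (y ∘ i.succAbove) := by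
  have := cullisForm_cons_single (F := F) i (fun _ : Fin 1 => y)
  rw [cullisForm_one] at this
  rw [← this]
  congr 1
  funext a
  fin_cases a <;> rfl

theorem AnnihilatesPair.adjacent_minor_three {m : ℕ} {u v : Fin (m + 2) → F}
    (h : AnnihilatesPair (m + 2) 3 u v) (i : Fin (m + 1)) :
    (u i.succ - u i.castSucc) * altSum (m + 2) v
      = (v i.succ - v i.castSucc) * altSum (m + 2) u := by
  set w := cullisForm F (m + 1) 2
  have hB : ∀ j : Fin (m + 2), w ![u ∘ j.succAbove, v ∘ j.succAbove] = 0 := fun j =>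
    h.comp_succAbove j _ 0 1 (by decide) rfl rfl
  have hupd : ∀ c a : Fin (m + 1) → F, Function.update ![0, c] 0 a = ![a, c] := fun c a => by
    funext l
    fin_cases l <;> rfl
  have hadd1 : ∀ a b c, w ![a + b, c] = w ![a, c] + w ![b, c] := fun a b c => by
    rw [← hupd c, w.map_update_add, hupd, hupd]
  have hsmul1 : ∀ (r : F) a c, w ![r • a, c] = r * w ![a, c] := fun r a c => by
    rw [← hupd c, w.map_update_smul, hupd, smul_eq_mul]
  have hswap : ∀ a c, w ![a, c] = - w ![c, a] := fun a c => by
    have := w.map_swap ![c, a] (i := 0) (j := 1) (by decide)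
    rw [← this]
    congr 1
    funext l
    fin_cases l <;> rfl
  have hself : ∀ a, w ![a, a] = 0 := fun a =>
    w.map_eq_zero_of_eq ![a, a] (i := 0) (j := 1) rfl (by decide)
  have hsing : ∀ r : F, (Pi.single i r : Fin (m + 1) → F) = r • Pi.single i 1 := fun r => by
    rw [← Pi.single_smul, smul_eq_mul, mul_one]
  have h1 := hB i.castSucc
  rw [comp_castSucc_succAbove, comp_castSucc_succAbove, hsing (u _ - _), hsing (v _ - _), hadd1,
    hsmul1, hswap,
    hadd1, hsmul1, hswap _ (v ∘ _ + _), hadd1, hsmul1, hself, hswap (v ∘ _) (u ∘ _), hB,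
    hswap (v ∘ _) (Pi.single i 1), cullisForm_two_single_left, cullisForm_two_single_left] at h1
  have hu := altSum_eq_delete_adjacent u i
  have hv := altSum_eq_delete_adjacent v i
  rw [hu, hv]
  have hne : (-1 : F) ^ (i : ℕ) ≠ 0 := pow_ne_zero _ (neg_ne_zero.mpr one_ne_zero)
  refine mul_left_cancel₀ hne ?_
  linear_combination h1

theorem Proportional.symm {n : ℕ} {u v : Fin n → F} (h : Proportional u v) :
    Proportional v u := fun p q => by rw [mul_comm, h q p, mul_comm]

theorem proportional_of_smul_eq {n : ℕ} {u v : Fin n → F} {a b : F} (ha : a ≠ 0)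
    (h : a • u = b • v) : Proportional u v := by
  intro p q
  have h1 : ∀ r, a * u r = b * v r := fun r => congrFun h r
  refine mul_left_cancel₀ ha ?_
  rw [← mul_assoc, ← mul_assoc, h1, h1]
  ring

theorem AnnihilatesPair.proportional_or_three {n : ℕ} (hn : Odd n) {u v : Fin n → F}
    (h : AnnihilatesPair n 3 u v) :
    Proportional u v ∨ (altSum n u = 0 ∧ altSum n v = 0) := by
  rcases n with _ | _ | m
  · exact absurd hn (by decide)
  · left
    intro p q
    rw [Subsingleton.elim (α := Fin 1) p q]
  · set c := altSum (m + 2) v • u + (-altSum (m + 2) u) • v with hc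
    have hc0 : c = fun _ => c 0 := by
      refine eq_of_adjacent_eq c fun i => ?_
      have := h.adjacent_minor_three i
      simp only [hc, Pi.add_apply, Pi.smul_apply, smul_eq_mul]
      linear_combination this
    have hc1 : altSum (m + 2) c = 0 := by
      rw [hc, altSum_add, altSum_smul, altSum_smul]
      ring
    rw [hc0, altSum_const hn] at hc1
    have hcz : altSum (m + 2) v • u = altSum (m + 2) u • v := by
      have : c = 0 := by
        rw [hc0, hc1]
        rfl
      rwa [hc, neg_smul, add_neg_eq_zero] at this
    by_cases hv : altSum (m + 2) v = 0
    · by_cases hu : altSum (m + 2) u = 0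
      · exact Or.inr ⟨hu, hv⟩
      · exact Or.inl (proportional_of_smul_eq hu hcz.symm).symm
    · exact Or.inl (proportional_of_smul_eq hv hcz)

theorem AnnihilatesPair.proportional_of_entry_ne {m k : ℕ} (hk : 2 ≤ k) (hkm : k ≤ m)
    (hmk : Even (m + k)) {u v : Fin (m + 1) → F} (h : AnnihilatesPair (m + 1) (k + 1) u v)
    {i : Fin (m + 1)} (hi : Proportional (u ∘ i.succAbove) (v ∘ i.succAbove)) {q : Fin m}
    (hq : v (i.succAbove q) ≠ 0) : Proportional u v := by
  set w := v (i.succAbove q) • u + (-u (i.succAbove q)) • v with hw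
  have hw1 : w = w i • Pi.single i 1 := by
    funext a
    rcases Fin.eq_self_or_eq_succAbove i a with rfl | ⟨a, rfl⟩
    · simp
    · have := hi a q
      simp only [Function.comp_apply] at this
      simp only [hw, Pi.add_apply, Pi.smul_apply, smul_eq_mul,
        Pi.single_eq_of_ne (Fin.succAbove_ne i a), mul_zero]
      linear_combination this
  have hann := h.smul_add_smul (v (i.succAbove q)) (-u (i.succAbove q))
  by_cases hwi : w i = 0
  · refine proportional_of_smul_eq (b := u (i.succAbove q)) hq ?_
    rw [hwi, zero_smul, hw, neg_smul, add_neg_eq_zero] at hw1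
    exact hw1
  · exfalso
    have h2 := hann.smul_add_smul (w i)⁻¹ 0
    rw [← hw, zero_smul, add_zero, hw1] at h2
    have hone : (w i)⁻¹ • w i • (Pi.single i 1 : Fin (m + 1) → F) = Pi.single i 1 := by
      rw [smul_smul, inv_mul_cancel₀ hwi, one_smul]
    simp only [Pi.smul_apply, Pi.single_eq_same, smul_eq_mul, mul_one] at h2
    rw [hone] at h2
    exact hq (congrFun (h2.inRadical_comp_succAbove.eq_zero hk hkm hmk) q)

theorem AnnihilatesPair.proportional_four {n : ℕ} (hn : Even n) (h4 : 4 ≤ n) {u v : Fin n → F}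
    (h : AnnihilatesPair n 4 u v) : Proportional u v := by
  obtain ⟨m, rfl⟩ : ∃ m, n = m + 1 := ⟨n - 1, by omega⟩
  by_cases hall : ∀ i : Fin (m + 1),
      altSum m (u ∘ i.succAbove) = 0 ∧ altSum m (v ∘ i.succAbove) = 0
  · have := eq_zero_of_altSum_comp_succAbove (by grind) u fun i => (hall i).1
    intro p q
    simp [this]
  · push Not at hall
    obtain ⟨i, hi⟩ := hall
    have hp : Proportional (u ∘ i.succAbove) (v ∘ i.succAbove) :=
      ((h.comp_succAbove i).proportional_or_three (by grind)).resolve_right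
        fun hh => hi hh.1 hh.2
    by_cases hv : ∃ q, v (i.succAbove q) ≠ 0
    · obtain ⟨q, hq⟩ := hv
      exact h.proportional_of_entry_ne (by omega) (by omega) (by grind) hp hq
    by_cases hu : ∃ q, u (i.succAbove q) ≠ 0
    · obtain ⟨q, hq⟩ := hu
      exact (h.symm.proportional_of_entry_ne (by omega) (by omega) (by grind) hp.symm hq).symm
    · push Not at hu hv
      refine absurd ?_ (hi (by simp [altSum, hu]))
      simp [altSum, hv]

theorem AnnihilatesPair.proportional_of_four_le {n k : ℕ} (hk : 4 ≤ k) (hkn : k ≤ n)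
    (hnk : Even (n + k)) {u v : Fin n → F} (h : AnnihilatesPair n k u v) : Proportional u v := by
  induction k, hk using Nat.le_induction generalizing n with
  | base => exact h.proportional_four (by grind) hkn
  | succ k hk ih =>
    obtain ⟨m, rfl⟩ : ∃ m, n = m + 1 := ⟨n - 1, by omega⟩
    intro p q
    obtain ⟨i, hi⟩ : ∃ i, i ∉ ({p, q} : Finset (Fin (m + 1))) := by
      by_contra! hcon
      have h1 := Finset.card_le_card (fun x _ => hcon x : Finset.univ ⊆ {p, q})
      have h2 := Finset.card_le_two (a := p) (b := q)
      simp at h1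
      omega
    simp only [Finset.mem_insert, Finset.mem_singleton, not_or] at hi
    obtain ⟨p, rfl⟩ := Fin.exists_succAbove_eq (Ne.symm hi.1)
    obtain ⟨q, rfl⟩ := Fin.exists_succAbove_eq (Ne.symm hi.2)
    exact ih (by omega) (by grind) (h.comp_succAbove i) p q

theorem AnnihilatesPair.proportional_or {n k : ℕ} (hk : 3 ≤ k) (hkn : k ≤ n)
    (hnk : Even (n + k)) {u v : Fin n → F} (h : AnnihilatesPair n k u v) :
    Proportional u v ∨ (altSum n u = 0 ∧ altSum n v = 0) := by
  rcases hk.eq_or_lt with rfl | hk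
  · exact h.proportional_or_three (by grind)
  · exact Or.inl (h.proportional_of_four_le hk hkn hnk)

theorem InRadical.of_position {n k : ℕ} {u : Fin n → F} (j : Fin k)
    (h : ∀ x : Fin k → Fin n → F, x j = u → cullisForm F n k x = 0) : InRadical n k u := by
  intro x l hl
  have h1 := h (x ∘ Equiv.swap j l) (by simp [hl])
  rw [AlternatingMap.map_perm] at h1
  rcases Int.units_eq_one_or (Equiv.Perm.sign (Equiv.swap j l)) with hs | hs <;>
    simpa [hs] using h1

theorem AnnihilatesPair.of_positions {n k : ℕ} {u v : Fin n → F} {i j : Fin k} (hij : i ≠ j)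
    (h : ∀ x : Fin k → Fin n → F, x i = u → x j = v → cullisForm F n k x = 0) :
    AnnihilatesPair n k u v := by
  intro x a b hab ha hb
  set τ := Equiv.swap i a
  have hτ : τ j ≠ a := fun e => hij (τ.injective ((Equiv.swap_apply_left i a).trans e.symm))
  set σ := Equiv.swap (τ j) b * τ with hσ
  have hi : σ i = a := by
    rw [hσ, Equiv.Perm.mul_apply, Equiv.swap_apply_left, Equiv.swap_apply_of_ne_of_ne hτ.symm hab]
  have hj : σ j = b := by rw [hσ, Equiv.Perm.mul_apply, Equiv.swap_apply_left]
  have h1 := h (x ∘ σ) (by simp [hi, ha]) (by simp [hj, hb])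
  rw [AlternatingMap.map_perm] at h1
  rcases Int.units_eq_one_or (Equiv.Perm.sign σ) with hs | hs <;> simpa [hs] using h1

/-- The coefficient of `λ ^ r` in the Cullis form at `x + λ y`. -/
def polarCoeff (n k r : ℕ) (x y : Fin k → Fin n → F) : F :=
  ∑ s : Finset (Fin k) with s.card = r, cullisForm F n k (s.piecewise y x)

theorem cullisForm_add_smul {n k : ℕ} (x y : Fin k → Fin n → F) (c : F) :
    cullisForm F n k (x + c • y)
      = ∑ r ∈ Finset.range (k + 1), c ^ r * polarCoeff n k r x y := by
  have h1 := (cullisForm F n k).toMultilinearMap.map_add_univ (c • y) x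
  rw [add_comm x]
  refine h1.trans ?_
  rw [← Finset.sum_fiberwise_of_maps_to (s := Finset.univ) (t := Finset.range (k + 1))
    (g := Finset.card) (fun s _ => Finset.mem_range.mpr
      (Nat.lt_succ_of_le (by simpa using Finset.card_le_univ s)))]
  refine Finset.sum_congr rfl fun r _ => ?_
  rw [polarCoeff, Finset.mul_sum]
  refine Finset.sum_congr rfl fun s hs => ?_
  have h2 := (cullisForm F n k).toMultilinearMap.map_piecewise_smul (fun _ => c)
    (s.piecewise y x) s
  rw [Finset.prod_const, (Finset.mem_filter.mp hs).2] at h2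
  refine Eq.trans ?_ h2
  congr 1
  funext j
  by_cases hj : j ∈ s <;> simp [hj]

theorem polarCoeff_eq_of_forall {n k : ℕ} (hF : (k : Cardinal) < Cardinal.mk F)
    {x y x' y' : Fin k → Fin n → F}
    (h : ∀ c : F, cullisForm F n k (x + c • y) = cullisForm F n k (x' + c • y')) {r : ℕ}
    (hr : r ≤ k) : polarCoeff n k r x y = polarCoeff n k r x' y' := by
  obtain ⟨S, hS⟩ := Cardinal.exists_finset_eq_card (α := F) (n := k + 1)
    (by exact_mod_cast Cardinal.natCast_add_one_le_iff.mpr hF)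
  let P : (Fin k → Fin n → F) → (Fin k → Fin n → F) → Polynomial F := fun x y =>
    ∑ r ∈ Finset.range (k + 1), Polynomial.monomial r (polarCoeff n k r x y)
  have heval : ∀ x y c, (P x y).eval c = cullisForm F n k (x + c • y) := fun x y c => by
    rw [cullisForm_add_smul, Polynomial.eval_finsetSum]
    exact Finset.sum_congr rfl fun r _ => by rw [Polynomial.eval_monomial, mul_comm]
  have hdeg : ∀ x y, (P x y).natDegree ≤ k := fun x y =>
    Polynomial.natDegree_sum_le_of_forall_le _ _ fun r hr =>
      (Polynomial.natDegree_monomial_le _).trans (Nat.lt_succ_iff.mp (Finset.mem_range.mp hr))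
  have hcoeff : ∀ x y, (P x y).coeff r = polarCoeff n k r x y := fun x y => by
    rw [Polynomial.finsetSum_coeff, Finset.sum_eq_single r]
    · simp
    · intro b _ hb
      exact Polynomial.coeff_monomial_of_ne _ hb.symm
    · intro hh
      exact absurd (Finset.mem_range.mpr (Nat.lt_succ_of_le hr)) hh
  rw [← hcoeff, ← hcoeff, Polynomial.eq_of_natDegree_lt_card_of_eval_eq' (P x y) (P x' y') S
    (fun c _ => by rw [heval, heval, h])
    (by rw [← hS]; exact Nat.lt_succ_of_le (max_le (hdeg _ _) (hdeg _ _)))]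

theorem polarCoeff_comm {n k r : ℕ} (hr : r ≤ k) (x y : Fin k → Fin n → F) :
    polarCoeff n k (k - r) y x = polarCoeff n k r x y := by
  unfold polarCoeff
  refine Finset.sum_nbij' (fun s => sᶜ) (fun s => sᶜ) ?_ ?_ ?_ ?_ ?_
  · intro s hs
    have := (Finset.mem_filter.mp hs).2
    simp [Finset.card_compl, this]
    omega
  · intro s hs
    have := (Finset.mem_filter.mp hs).2
    simp [Finset.card_compl, this]
  · intro s _
    exact compl_compl s
  · intro s _
    exact compl_compl s
  · intro s _
    rw [Finset.piecewise_compl]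

theorem polarCoeff_one {n k : ℕ} (x y : Fin k → Fin n → F) :
    polarCoeff n k 1 x y = ∑ j, cullisForm F n k (Function.update x j (y j)) := by
  unfold polarCoeff
  symm
  refine Finset.sum_bij (fun j _ => {j}) ?_ ?_ ?_ ?_
  · intro j _
    simp
  · intro i _ j _ hij
    exact Finset.singleton_injective hij
  · intro s hs
    obtain ⟨j, rfl⟩ := Finset.card_eq_one.mp (Finset.mem_filter.mp hs).2
    exact ⟨j, Finset.mem_univ _, rfl⟩
  · intro j _
    rw [Finset.piecewise_singleton]

/-- The differential of the Cullis form at `x`. -/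
def polar (n k : ℕ) (x : Fin k → Fin n → F) : (Fin k → Fin n → F) →ₗ[F] F :=
  ∑ j, ((cullisForm F n k).toMultilinearMap.toLinearMap x j).comp (LinearMap.proj j)

theorem polar_apply {n k : ℕ} (x y : Fin k → Fin n → F) :
    polar n k x y = polarCoeff n k 1 x y := by
  rw [polarCoeff_one, polar, LinearMap.sum_apply]
  rfl

theorem eq_zero_of_polar_eq_zero {n k : ℕ} (hk : 2 ≤ k) (hkn : k ≤ n) (hnk : Even (n + k))
    (z : Fin k → Fin n → F) (h : ∀ x, polar n k x z = 0) : z = 0 := by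
  funext j
  refine InRadical.eq_zero hk hkn hnk (InRadical.of_position j fun x hx => ?_)
  have h1 := h (Function.update x j 0)
  rw [polar_apply, polarCoeff_one, Finset.sum_eq_single j] at h1
  · rwa [Function.update_idem, ← hx, Function.update_eq_self] at h1
  · intro i _ hi
    exact AlternatingMap.map_coord_zero _ j (by simp [hi.symm])
  · simp

theorem annihilatesPair_of_polarCoeff_two {n k : ℕ} (y : Fin k → Fin n → F)
    (h : ∀ x, polarCoeff n k 2 x y = 0) {i j : Fin k} (hij : i ≠ j) :
    AnnihilatesPair n k (y i) (y j) := by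
  refine AnnihilatesPair.of_positions hij fun x hi hj => ?_
  have h1 := h (Function.update (Function.update x i 0) j 0)
  rw [polarCoeff, Finset.sum_eq_single {i, j}] at h1
  · rw [← h1]
    congr 1
    funext l
    by_cases hli : l = i
    · subst hli
      simp [hi]
    · by_cases hlj : l = j
      · subst hlj
        simp [hj]
      · simp [hli, hlj]
  · intro s hs hne
    by_cases his : i ∈ s
    · by_cases hjs : j ∈ s
      · refine absurd (Finset.eq_of_subset_of_card_le ?_ ?_).symm hne
        · intro l hl
          rcases Finset.mem_insert.mp hl with rfl | hl
          · exact his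
          · rwa [Finset.mem_singleton.mp hl]
        · rw [(Finset.mem_filter.mp hs).2, Finset.card_pair hij]
      · exact AlternatingMap.map_coord_zero _ j (by simp [hjs])
    · exact AlternatingMap.map_coord_zero _ i (by simp [his, hij])
  · intro hh
    exact (hh (by simp [Finset.card_pair hij])).elim

theorem polarCoeff_two_rank_one {n k : ℕ} (x : Fin k → Fin n → F) (b : Fin k → F)
    (v : Fin n → F) : polarCoeff n k 2 x (fun j => b j • v) = 0 := by
  refine Finset.sum_eq_zero fun s hs => ?_
  obtain ⟨i, j, hij, rfl⟩ := Finset.card_eq_two.mp (Finset.mem_filter.mp hs).2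
  set z := Finset.piecewise {i, j} (fun j => b j • v) x with hz
  have h1 : z = Function.update (Function.update z i (b i • v)) j (b j • v) := by
    funext l
    by_cases hlj : l = j
    · subst hlj
      simp [hz]
    · by_cases hli : l = i
      · subst hli
        simp [hz, hij]
      · simp [hli, hlj]
  rw [h1, AlternatingMap.map_update_smul, Function.update_comm hij,
    AlternatingMap.map_update_smul,
    AlternatingMap.map_eq_zero_of_eq _ _ (i := i) (j := j) (by simp [hij.symm]) hij]
  simp

theorem exists_linearEquiv_of_pairing {W : Type*} [AddCommGroup W] [Module F W]
    [FiniteDimensional F W] (D : W → W →ₗ[F] F) (hD : ∀ z, (∀ x, D x z = 0) → z = 0)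
    (f g : W → W) (h : ∀ x y, D (f x) (g y) = D x y) : ∃ L : W ≃ₗ[F] W, ∀ y, g y = L y := by
  let L₀ : W →ₗ[F] (W → F) := LinearMap.pi D
  let L₁ : W →ₗ[F] (W → F) := LinearMap.pi fun x => D (f x)
  have hL : ∀ y, L₁ (g y) = L₀ y := fun y => funext fun x => h x y
  have hinj₀ : Function.Injective L₀ := by
    rw [injective_iff_map_eq_zero]
    exact fun z hz => hD z fun x => congrFun hz x
  have hle : LinearMap.range L₀ ≤ LinearMap.range L₁ := by
    rintro _ ⟨y, rfl⟩
    exact ⟨g y, hL y⟩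
  have hinj₁ : Function.Injective L₁ := by
    rw [← LinearMap.ker_eq_bot, ← Submodule.finrank_eq_zero (R := F)]
    have h1 := Submodule.finrank_mono hle
    rw [LinearMap.finrank_range_of_inj hinj₀] at h1
    have h2 := L₁.finrank_range_add_finrank_ker
    omega
  let G : W →ₗ[F] W :=
    { toFun := g
      map_add' := fun y y' => hinj₁ (by rw [map_add, hL, hL, hL, map_add])
      map_smul' := fun c y => hinj₁ (by rw [map_smul, hL, hL, map_smul, RingHom.id_apply]) }
  have hG : Function.Injective G := fun y y' hy => hinj₀ (by
    rw [← hL, ← hL]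
    exact congrArg L₁ hy)
  exact ⟨LinearEquiv.ofInjectiveEndo G hG, fun y => rfl⟩

theorem exists_linearEquiv_of_preserves {n k : ℕ} (hk : 2 ≤ k) (hkn : k ≤ n)
    (hnk : Even (n + k)) (hF : (k : Cardinal) < Cardinal.mk F)
    (f g : (Fin k → Fin n → F) → Fin k → Fin n → F)
    (h : ∀ x y (c : F), cullisForm F n k (x + c • y) = cullisForm F n k (f x + c • g y)) :
    ∃ L : (Fin k → Fin n → F) ≃ₗ[F] (Fin k → Fin n → F), (∀ x, f x = L x) ∧ ∀ x, g x = L x := by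
  have hcoeff : ∀ x y {r : ℕ}, r ≤ k →
      polarCoeff n k r x y = polarCoeff n k r (f x) (g y) := fun x y r hr =>
    polarCoeff_eq_of_forall hF (h x y) hr
  have hg : ∀ x y, polar n k (f x) (g y) = polar n k x y := fun x y => by
    rw [polar_apply, polar_apply, hcoeff x y (by omega)]
  have hf : ∀ x y, polar n k (g x) (f y) = polar n k x y := fun x y => by
    have := hcoeff y x (r := k - 1) (by omega)
    rwa [polarCoeff_comm (by omega), polarCoeff_comm (by omega), ← polar_apply, ← polar_apply,
      eq_comm] at this
  have hnd := eq_zero_of_polar_eq_zero (F := F) hk hkn hnk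
  obtain ⟨L, hL⟩ := exists_linearEquiv_of_pairing (polar n k) hnd f g hg
  obtain ⟨M, hM⟩ := exists_linearEquiv_of_pairing (polar n k) hnd g f hf
  have hMM : ∀ x y, polar n k (M x) (M y) = polar n k x y := fun x y => by
    have hform : ∀ z, cullisForm F n k z = cullisForm F n k (M z) := fun z => by
      have := h z 0 0
      rwa [zero_smul, zero_smul, add_zero, add_zero, hM] at this
    have := polarCoeff_eq_of_forall hF (x := x) (y := y) (x' := M x) (y' := M y)
      (fun c => by rw [hform, map_add, map_smul]) (r := 1) (by omega)
    rw [polar_apply, polar_apply, this]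
  have hLM : ∀ y, L y = M y := fun y => by
    refine sub_eq_zero.mp (hnd _ fun x => ?_)
    rw [map_sub, ← M.apply_symm_apply x, hMM, ← hM, ← hL, hg, sub_self]
  exact ⟨L, fun x => by rw [hM, hLM], hL⟩

theorem Proportional.trans {n : ℕ} {u v w : Fin n → F} (hu : u ≠ 0) (hv : Proportional u v)
    (hw : Proportional u w) : Proportional v w := by
  obtain ⟨p, hp⟩ := Function.ne_iff.mp hu
  intro x y
  refine mul_left_cancel₀ (mul_ne_zero hp hp) ?_
  linear_combination u p * w y * hv p x + u x * v p * hw p y - u p * v y * hw p x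
    - hv p y * u x * w p

/-- All rows of `y` are proportional, i.e. `y` has rank at most one. -/
def RankLeOne {n k : ℕ} (y : Fin k → Fin n → F) : Prop :=
  ∀ i j, Proportional (y i) (y j)

theorem RankLeOne.of_pairs {n k : ℕ} (s : (Fin n → F) →ₗ[F] F) {y : Fin k → Fin n → F}
    (h : ∀ i j, Proportional (y i) (y j) ∨ (s (y i) = 0 ∧ s (y j) = 0)) {i : Fin k}
    (hi : s (y i) ≠ 0) : RankLeOne y := fun a b => by
  have h1 : ∀ a, Proportional (y i) (y a) := fun a => (h i a).resolve_right fun hh => hi hh.1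
  refine Proportional.trans (fun h0 => hi ?_) (h1 a) (h1 b)
  rw [h0, map_zero]

theorem RankLeOne.exists_factor {n k : ℕ} {y : Fin k → Fin n → F} (h : RankLeOne y) :
    ∃ (c : Fin k → F) (a : Fin n → F), ∀ l p, y l p = c l * a p := by
  by_cases h0 : y = 0
  · exact ⟨0, 0, fun l p => by simp [h0]⟩
  obtain ⟨l₀, hl⟩ := Function.ne_iff.mp h0
  obtain ⟨p₀, hp⟩ := Function.ne_iff.mp hl
  refine ⟨fun l => y l p₀ / y l₀ p₀, y l₀, fun l p => ?_⟩
  have hp' : y l₀ p₀ ≠ 0 := hp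
  have := h l l₀ p₀ p
  field_simp
  linear_combination -this

theorem exists_ne_zero_of_pos {n : ℕ} (hn : 0 < n) : ∃ v : Fin n → F, v ≠ 0 :=
  ⟨Pi.single ⟨0, hn⟩ 1, by simp⟩

/-- Two matrices `c ⊗ a` and `d ⊗ b` whose sum has rank at most one. -/
theorem minors_of_add {n k : ℕ} {y z : Fin k → Fin n → F} (h : RankLeOne (y + z))
    {c d : Fin k → F} {a b : Fin n → F} (hy : ∀ l p, y l p = c l * a p)
    (hz : ∀ l p, z l p = d l * b p) (l m : Fin k) (p q : Fin n) :
    (c l * d m - c m * d l) * (a p * b q - a q * b p) = 0 := by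
  have := h l m p q
  simp only [Pi.add_apply, hy, hz] at this
  linear_combination this

theorem exists_common_column_space {n k : ℕ} (hkn : k < n)
    (g : (Fin n → F) →ₗ[F] (Fin k → Fin n → F)) (hg : Function.Injective g)
    (h1 : ∀ v, RankLeOne (g v)) (v v' : Fin n → F) (l l' : Fin k) (p p' : Fin n) :
    g v l p * g v' l' p' = g v l' p * g v' l p' := by
  by_contra hne
  obtain ⟨c, a, hy⟩ := (h1 v).exists_factor
  obtain ⟨d, b, hz⟩ := (h1 v').exists_factor
  simp only [hy, hz] at hne
  have hcd : c l * d l' - c l' * d l ≠ 0 := fun h0 => hne (by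
    linear_combination a p * b p' * h0)
  have hap : a p ≠ 0 := fun h0 => hne (by rw [h0]; ring)
  have hbp' : b p' ≠ 0 := fun h0 => hne (by rw [h0]; ring)
  have hab : ∀ q, a p * b q - a q * b p = 0 := fun q =>
    (mul_eq_zero.mp (minors_of_add (map_add g v v' ▸ h1 (v + v')) hy hz l l' p q)).resolve_left hcd
  have hbp : b p ≠ 0 := fun h0 => mul_ne_zero hap hbp' (by
    have := hab p'
    rw [h0] at this
    linear_combination this)
  have hrow : ∀ w m q, a p * g w m q = a q * g w m p := fun w m q => by
    obtain ⟨e, f, hw⟩ := (h1 w).exists_factor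
    by_contra hwne
    simp only [hw] at hwne
    have haf : a p * f q - a q * f p ≠ 0 := fun h0 => hwne (by linear_combination e m * h0)
    have hbf : b p * f q - b q * f p ≠ 0 := fun h0 => mul_ne_zero hbp haf (by
      linear_combination a p * h0 + f p * hab q)
    have hce : ∀ i j, c i * e j - c j * e i = 0 := fun i j =>
      (mul_eq_zero.mp (minors_of_add (map_add g v w ▸ h1 (v + w)) hy hw i j p q)).resolve_right haf
    have hde : ∀ i j, d i * e j - d j * e i = 0 := fun i j =>
      (mul_eq_zero.mp
        (minors_of_add (map_add g v' w ▸ h1 (v' + w)) hz hw i j p q)).resolve_right hbf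
    have hem : e m = 0 := (mul_eq_zero.mp (show (c l * d l' - c l' * d l) * e m = 0 by
      linear_combination d l' * hce l m - d l * hce l' m - c m * hde l l')).resolve_left hcd
    exact hwne (by rw [hem]; ring)
  let G : (Fin n → F) →ₗ[F] (Fin k → F) := LinearMap.pi fun m =>
    (LinearMap.proj p).comp ((LinearMap.proj m).comp g)
  have hG : Function.Injective G := by
    rw [injective_iff_map_eq_zero]
    intro w hw
    refine (injective_iff_map_eq_zero g).mp hg w (funext fun m => funext fun q => ?_)
    have h0 : g w m p = 0 := congrFun hw m
    have := hrow w m q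
    rw [h0, mul_zero] at this
    exact (mul_eq_zero.mp this).resolve_left hap
  have := LinearMap.finrank_le_finrank_of_injective hG
  simp only [Module.finrank_fin_fun] at this
  omega

theorem exists_factor_of_rankLeOne {n k : ℕ} (hkn : k < n)
    (g : (Fin n → F) →ₗ[F] (Fin k → Fin n → F)) (hg : Function.Injective g)
    (h1 : ∀ v, RankLeOne (g v)) :
    ∃ (c : Fin k → F) (A : (Fin n → F) ≃ₗ[F] (Fin n → F)), c ≠ 0 ∧ ∀ v l, g v l = c l • A v := by
  obtain ⟨v₀, hv⟩ := exists_ne_zero_of_pos (F := F) (by omega : 0 < n)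
  have hgv : g v₀ ≠ 0 := fun h0 => hv (hg (h0.trans (map_zero g).symm))
  obtain ⟨l₀, hl⟩ := Function.ne_iff.mp hgv
  obtain ⟨p₀, hp⟩ := Function.ne_iff.mp hl
  have hp' : g v₀ l₀ p₀ ≠ 0 := hp
  let A₀ : (Fin n → F) →ₗ[F] (Fin n → F) := (LinearMap.proj l₀).comp g
  have hfac : ∀ v l, g v l = (g v₀ l p₀ / g v₀ l₀ p₀) • A₀ v := fun v l => funext fun q => by
    have := exists_common_column_space hkn g hg h1 v₀ v l l₀ p₀ q
    change g v l q = g v₀ l p₀ / g v₀ l₀ p₀ * g v l₀ q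
    field_simp
    linear_combination -this
  have hA : Function.Injective A₀ := by
    rw [injective_iff_map_eq_zero]
    intro w hw
    refine (injective_iff_map_eq_zero g).mp hg w (funext fun m => ?_)
    rw [hfac, hw, smul_zero]
    rfl
  exact ⟨fun l => g v₀ l p₀ / g v₀ l₀ p₀, LinearEquiv.ofInjectiveEndo A₀ hA,
    fun h0 => one_ne_zero ((div_self hp').symm.trans (congrFun h0 l₀)), hfac⟩

theorem rankLeOne_of_exists {n k : ℕ} {t : F} (ht0 : t ≠ 0) (ht1 : t ≠ 1)
    (s : (Fin n → F) →ₗ[F] F) (g : (Fin n → F) →ₗ[F] (Fin k → Fin n → F))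
    (hs : ∀ v i j, Proportional (g v i) (g v j) ∨ (s (g v i) = 0 ∧ s (g v j) = 0))
    {v₀ : Fin n → F} {l : Fin k} (hv : s (g v₀ l) ≠ 0) (v : Fin n → F) : RankLeOne (g v) := by
  by_cases hl : s (g v l) = 0
  · have hgood : ∀ c : F, c ≠ 0 → RankLeOne (g (v + c • v₀)) := fun c hc => by
      refine RankLeOne.of_pairs s (i := l) (hs _) ?_
      rw [map_add, map_smul, Pi.add_apply, Pi.smul_apply, map_add, map_smul, hl, zero_add,
        smul_eq_mul]
      exact mul_ne_zero hc hv
    intro i j p q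
    have hz := RankLeOne.of_pairs s (hs v₀) hv i j p q
    have e1 := hgood 1 one_ne_zero i j p q
    have e2 := hgood t ht0 i j p q
    simp only [map_add, map_smul, Pi.add_apply, Pi.smul_apply, smul_eq_mul] at e1 e2
    refine mul_left_cancel₀ (sub_ne_zero.mpr ht1) ?_
    linear_combination t * e1 - e2 + (t ^ 2 - t) * hz
  · exact RankLeOne.of_pairs s (hs v) hl

theorem exists_smul_of_combination {n k : ℕ} (hn : 0 < n) {c₀ c₁ c : Fin k → F}
    (hc₁ : c₁ ≠ 0) (N₀ N₁ M : (Fin n → F) ≃ₗ[F] (Fin n → F))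
    (h : ∀ v l, c₀ l • N₀ v + c₁ l • N₁ v = c l • M v)
    (hinj : ∀ v v', (∀ l, c₀ l • N₀ v + c₁ l • N₁ v' = 0) → v = 0) :
    ∃ γ : F, ∀ v, N₁ v = γ • N₀ v := by
  obtain ⟨w, hw⟩ := exists_ne_zero_of_pos (F := F) hn
  by_cases hm : ∀ l m, c₀ l * c₁ m = c₀ m * c₁ l
  · obtain ⟨i, hi⟩ := Function.ne_iff.mp hc₁
    have hi' : c₁ i ≠ 0 := hi
    refine absurd (hinj w (N₁.symm (-(c₀ i / c₁ i) • N₀ w)) fun l => ?_) hw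
    rw [LinearEquiv.apply_symm_apply, smul_smul, ← add_smul]
    convert zero_smul F _
    have := hm l i
    field_simp
    linear_combination this
  · push Not at hm
    obtain ⟨l, m, hlm⟩ := hm
    have hδ : c₀ l * c₁ m - c₀ m * c₁ l ≠ 0 := sub_ne_zero.mpr hlm
    have e0 : ∀ v, (c₀ l * c₁ m - c₀ m * c₁ l) • N₀ v = (c l * c₁ m - c m * c₁ l) • M v :=
      fun v => by
        funext p
        have h1 := congrFun (h v l) p
        have h2 := congrFun (h v m) p
        simp only [Pi.add_apply, Pi.smul_apply, smul_eq_mul] at h1 h2 ⊢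
        linear_combination c₁ m * h1 - c₁ l * h2
    have e1 : ∀ v, (c₀ l * c₁ m - c₀ m * c₁ l) • N₁ v = (c₀ l * c m - c₀ m * c l) • M v :=
      fun v => by
        funext p
        have h1 := congrFun (h v l) p
        have h2 := congrFun (h v m) p
        simp only [Pi.add_apply, Pi.smul_apply, smul_eq_mul] at h1 h2 ⊢
        linear_combination c₀ l * h2 - c₀ m * h1
    have hα : c l * c₁ m - c m * c₁ l ≠ 0 := fun h0 => by
      have := e0 w
      rw [h0, zero_smul, smul_eq_zero] at this
      exact hw (by simpa using this.resolve_left hδ)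
    refine ⟨(c₀ l * c m - c₀ m * c l) / (c l * c₁ m - c m * c₁ l), fun v => ?_⟩
    refine smul_right_injective _ (mul_ne_zero hα hδ) ?_
    funext p
    have h1 := congrFun (e0 v) p
    have h2 := congrFun (e1 v) p
    simp only [Pi.smul_apply, smul_eq_mul] at h1 h2 ⊢
    field_simp
    linear_combination (c l * c₁ m - c m * c₁ l) * h2 - (c₀ l * c m - c₀ m * c l) * h1

/-- The linear map `v ↦ b ⊗ v`. -/
def outerLeft {k : ℕ} (n : ℕ) (b : Fin k → F) : (Fin n → F) →ₗ[F] (Fin k → Fin n → F) :=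
  LinearMap.pi fun j => b j • LinearMap.id

theorem outerLeft_apply {n k : ℕ} (b : Fin k → F) (v : Fin n → F) :
    outerLeft n b v = fun j => b j • v := rfl

theorem outerLeft_add {n k : ℕ} (b b' : Fin k → F) (v : Fin n → F) :
    outerLeft n (b + b') v = outerLeft n b v + outerLeft n b' v :=
  funext fun j => add_smul (b j) (b' j) v

theorem outerLeft_zero {n k : ℕ} (v : Fin n → F) : outerLeft n (0 : Fin k → F) v = 0 :=
  funext fun _ => zero_smul F v

theorem outerLeft_injective {n k : ℕ} {b : Fin k → F} (hb : b ≠ 0) :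
    Function.Injective (outerLeft n b) := by
  obtain ⟨j, hj⟩ := Function.ne_iff.mp hb
  exact fun v w h => smul_right_injective _ hj (congrFun h j)

theorem sum_outerLeft_single {n k : ℕ} (x : Fin k → Fin n → F) :
    ∑ j, outerLeft n (Pi.single j 1) (x j) = x := by
  funext l
  rw [Finset.sum_apply, Finset.sum_eq_single l]
  · simp [outerLeft_apply]
  · intro j _ hj
    simp [outerLeft_apply, hj.symm]
  · simp

section RankOnePreserver

variable {n k : ℕ} (Φ : (Fin k → Fin n → F) ≃ₗ[F] (Fin k → Fin n → F)) (s : (Fin n → F) →ₗ[F] F)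

theorem exists_factor_of_good (hkn : k < n) {t : F} (ht0 : t ≠ 0) (ht1 : t ≠ 1)
    (hΦ : ∀ b v i j, Proportional (Φ (outerLeft n b v) i) (Φ (outerLeft n b v) j) ∨
      (s (Φ (outerLeft n b v) i) = 0 ∧ s (Φ (outerLeft n b v) j) = 0))
    {b : Fin k → F} (hb : b ≠ 0) (hgood : ∃ v l, s (Φ (outerLeft n b v) l) ≠ 0) :
    ∃ (c : Fin k → F) (A : (Fin n → F) ≃ₗ[F] (Fin n → F)), c ≠ 0 ∧
      ∀ v l, Φ (outerLeft n b v) l = c l • A v := by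
  obtain ⟨v₀, l, hv⟩ := hgood
  exact exists_factor_of_rankLeOne hkn (Φ.toLinearMap.comp (outerLeft n b))
    (Φ.injective.comp (outerLeft_injective hb))
    (rankLeOne_of_exists ht0 ht1 s (Φ.toLinearMap.comp (outerLeft n b)) (hΦ b) hv)

theorem exists_good (hk : 0 < k) (hs : s ≠ 0) :
    ∃ b : Fin k → F, ∃ v l, s (Φ (outerLeft n b v) l) ≠ 0 := by
  by_contra! hcon
  refine hs (LinearMap.ext fun w => ?_)
  have h1 : ∀ x l, s (Φ x l) = 0 := fun x l => by
    rw [← sum_outerLeft_single x, map_sum, Finset.sum_apply, map_sum]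
    exact Finset.sum_eq_zero fun j _ => hcon _ _ _
  simpa using h1 (Φ.symm fun _ => w) ⟨0, hk⟩

theorem good_of_ne_zero (hk : 0 < k) (hkn : k < n) {t : F} (ht0 : t ≠ 0) (ht1 : t ≠ 1)
    (hs : s ≠ 0)
    (hΦ : ∀ b v i j, Proportional (Φ (outerLeft n b v) i) (Φ (outerLeft n b v) j) ∨
      (s (Φ (outerLeft n b v) i) = 0 ∧ s (Φ (outerLeft n b v) j) = 0))
    {b : Fin k → F} (hb : b ≠ 0) : ∃ v l, s (Φ (outerLeft n b v) l) ≠ 0 := by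
  by_contra! hbad
  obtain ⟨b₂, hb₂⟩ := exists_good Φ s hk hs
  have hb₂0 : b₂ ≠ 0 := by
    rintro rfl
    obtain ⟨v, l, hv⟩ := hb₂
    refine hv ?_
    simp [outerLeft_zero]
  have hsum : ∀ v l, s (Φ (outerLeft n (b + b₂) v) l) = s (Φ (outerLeft n b₂ v) l) :=
    fun v l => by rw [outerLeft_add, map_add, Pi.add_apply, map_add, hbad, zero_add]
  have hb₃ : ∃ v l, s (Φ (outerLeft n (b + b₂) v) l) ≠ 0 := by
    obtain ⟨v, l, hv⟩ := hb₂
    exact ⟨v, l, by rwa [hsum]⟩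
  have hb₃0 : b + b₂ ≠ 0 := fun h0 => by
    obtain ⟨v, l, hv⟩ := hb₃
    refine hv ?_
    simp [h0, outerLeft_zero]
  obtain ⟨c, N, hc, hN⟩ := exists_factor_of_good Φ s hkn ht0 ht1 hΦ hb₂0 hb₂
  obtain ⟨c', M, hc', hM⟩ := exists_factor_of_good Φ s hkn ht0 ht1 hΦ hb₃0 hb₃
  have hcs : ∀ v l, c' l * s (M v) = c l * s (N v) := fun v l => by
    have := hsum v l
    rwa [hM, hN, map_smul, map_smul] at this
  obtain ⟨w, hw⟩ := DFunLike.ne_iff.mp hs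
  have hw' : s w ≠ 0 := hw
  set μ := s (M (N.symm w)) / s w with hμ
  have hcμ : ∀ l, c l = c' l * μ := fun l => by
    have := hcs (N.symm w) l
    rw [LinearEquiv.apply_symm_apply] at this
    rw [hμ]
    field_simp
    linear_combination -this
  let K : (Fin n → F) →ₗ[F] (Fin n → F) := M.toLinearMap - μ • N.toLinearMap
  have hK : ∀ v l, Φ (outerLeft n b v) l = c' l • K v := fun v l => by
    have h1 : Φ (outerLeft n (b + b₂) v) l = Φ (outerLeft n b v) l + Φ (outerLeft n b₂ v) l := by
      rw [outerLeft_add, map_add, Pi.add_apply]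
    rw [hM, hN, hcμ] at h1
    rw [eq_sub_of_add_eq h1.symm]
    simp [K, smul_sub, smul_smul]
  have hKinj : Function.Injective K := by
    rw [injective_iff_map_eq_zero]
    intro v hv
    have h0 : Φ (outerLeft n b v) = 0 := funext fun l => by rw [hK, hv, smul_zero]; rfl
    exact outerLeft_injective hb (by simpa using h0)
  obtain ⟨l, hl⟩ := Function.ne_iff.mp hc'
  obtain ⟨v, hv⟩ := LinearMap.injective_iff_surjective.mp hKinj w
  have := hbad v l
  rw [hK, hv, map_smul] at this
  exact mul_ne_zero hl hw' this

theorem exists_mul_of_rankOne_preserver (hk : 0 < k) (hkn : k < n) {t : F} (ht0 : t ≠ 0)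
    (ht1 : t ≠ 1) (hs : s ≠ 0)
    (hΦ : ∀ b v i j, Proportional (Φ (outerLeft n b v) i) (Φ (outerLeft n b v) j) ∨
      (s (Φ (outerLeft n b v) i) = 0 ∧ s (Φ (outerLeft n b v) j) = 0)) :
    ∃ (A : (Fin n → F) →ₗ[F] (Fin n → F)) (B : Matrix (Fin k) (Fin k) F),
      ∀ x l, Φ x l = ∑ j, B j l • A (x j) := by
  have hfac : ∀ b : Fin k → F, b ≠ 0 → ∃ (c : Fin k → F)
      (A : (Fin n → F) ≃ₗ[F] (Fin n → F)), c ≠ 0 ∧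
      ∀ v l, Φ (outerLeft n b v) l = c l • A v := fun b hb =>
    exists_factor_of_good Φ s hkn ht0 ht1 hΦ hb (good_of_ne_zero Φ s hk hkn ht0 ht1 hs hΦ hb)
  choose c N hc hN using fun j : Fin k => hfac (Pi.single j 1) (by simp)
  let j₀ : Fin k := ⟨0, hk⟩
  have hγ : ∀ j, ∃ γ : F, ∀ v, N j v = γ • N j₀ v := fun j => by
    by_cases hj : j = j₀
    · exact ⟨1, fun v => by rw [hj, one_smul]⟩
    obtain ⟨d, M, -, hM⟩ := hfac (Pi.single j₀ 1 + Pi.single j 1) fun h0 => by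
      have := congrFun h0 j
      simp [hj] at this
    refine exists_smul_of_combination (c₀ := c j₀) (c := d) (by omega) (hc j) (N j₀) (N j) M (fun v l => ?_)
      fun v v' hv => ?_
    · rw [← hN, ← hN, ← hM, outerLeft_add, map_add, Pi.add_apply]
    · have h0 : Φ (outerLeft n (Pi.single j₀ 1) v + outerLeft n (Pi.single j 1) v') = 0 :=
        funext fun l => by rw [map_add, Pi.add_apply, hN, hN, hv]; rfl
      have h1 := congrFun (Φ.map_eq_zero_iff.mp h0) j₀
      simpa [outerLeft_apply, Ne.symm hj] using h1
  choose γ hγ using hγ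
  refine ⟨(N j₀).toLinearMap, Matrix.of fun j l => c j l * γ j, fun x l => ?_⟩
  conv_lhs => rw [← sum_outerLeft_single x, map_sum, Finset.sum_apply]
  refine Finset.sum_congr rfl fun j _ => ?_
  rw [hN, hγ, smul_smul]
  rfl

end RankOnePreserver

theorem cullisDet_mul {n k : ℕ} (X : Matrix (Fin n) (Fin k) F) (B : Matrix (Fin k) (Fin k) F) :
    cullisDet (X * B) = cullisDet X * B.det := by
  unfold cullisDet
  rw [Finset.sum_mul]
  refine Finset.sum_congr rfl fun f _ => ?_
  split_ifs
  · rw [mul_assoc, ← Matrix.det_mul]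
    rfl
  · rw [zero_mul]

/-- The Cullis determinant of the matrix whose columns are the standard basis vectors indexed
by `f`. -/
theorem cullisDet_single {n k : ℕ} {f : Fin k → Fin n} (hf : StrictMono f) :
    cullisDet (Matrix.of fun i j => if i = f j then (1 : F) else 0)
      = (-1) ^ ((∑ t : Fin k, ((f t : ℕ) + 1)) + (∑ t : Fin k, ((t : ℕ) + 1))) := by
  unfold cullisDet
  rw [Finset.sum_eq_single f]
  · rw [if_pos hf]
    convert mul_one _
    convert Matrix.det_one (n := Fin k) (R := F)
    ext i j
    simp [Matrix.one_apply, hf.injective.eq_iff]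
  · intro g _ hne
    split_ifs with hg
    · have hi : ∃ i, g i ∉ Set.range f := by
        by_contra! hcon
        have hsub : Finset.univ.image g ⊆ Finset.univ.image f := fun x hx => by
          obtain ⟨i, -, rfl⟩ := Finset.mem_image.mp hx
          obtain ⟨j, hj⟩ := hcon i
          exact Finset.mem_image.mpr ⟨j, Finset.mem_univ j, hj⟩
        have heq := Finset.eq_of_subset_of_card_le hsub (by
          rw [Finset.card_image_of_injective _ hf.injective,
            Finset.card_image_of_injective _ hg.injective])
        refine hne ((hg.range_inj hf).mp ?_)
        simpa using congrArg (fun s : Finset (Fin n) => (s : Set (Fin n))) heq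
      obtain ⟨i, hi⟩ := hi
      rw [Matrix.det_eq_zero_of_row_eq_zero i fun j => ?_, mul_zero]
      exact if_neg fun h0 => hi ⟨j, h0.symm⟩
    · rfl
  · simp

/-- `altSum` as a linear functional. -/
def altSumLinear (F : Type*) [Field F] (n : ℕ) : (Fin n → F) →ₗ[F] F where
  toFun := altSum n
  map_add' := altSum_add
  map_smul' := altSum_smul

theorem altSumLinear_ne_zero {n : ℕ} (hn : 0 < n) : altSumLinear F n ≠ 0 := fun h0 => by
  have h1 := DFunLike.congr_fun h0 (Pi.single ⟨0, hn⟩ 1)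
  change altSum n _ = 0 at h1
  rw [altSum_single] at h1
  simp at h1

theorem exists_ne_zero_ne_one {k : ℕ} (hk : 3 ≤ k) (hF : (k : Cardinal) < Cardinal.mk F) :
    ∃ t : F, t ≠ 0 ∧ t ≠ 1 := by
  obtain ⟨S, hS⟩ := Cardinal.exists_finset_eq_card (α := F) (n := k) hF.le
  obtain ⟨t, ht, ht'⟩ := Finset.exists_mem_notMem_of_card_lt_card (s := {0, 1}) (t := S)
    (by rw [← hS]; exact Finset.card_le_two.trans_lt hk)
  simp only [Finset.mem_insert, Finset.mem_singleton, not_or] at ht'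
  exact ⟨t, ht'⟩

/-- A linear automorphism preserving the Cullis form is a two-sided multiplication. -/
theorem exists_mul_of_preserves {n k : ℕ} (hk : 3 ≤ k) (hn : k < n) (hnk : Even (n + k))
    (hF : (k : Cardinal) < Cardinal.mk F) (L : (Fin k → Fin n → F) ≃ₗ[F] (Fin k → Fin n → F))
    (hL : ∀ x, cullisForm F n k (L x) = cullisForm F n k x) :
    ∃ (A : (Fin n → F) →ₗ[F] (Fin n → F)) (B : Matrix (Fin k) (Fin k) F),
      ∀ x l, L x l = ∑ j, B j l • A (x j) := by
  obtain ⟨t, ht0, ht1⟩ := exists_ne_zero_ne_one hk hF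
  refine exists_mul_of_rankOne_preserver L (altSumLinear F n) (by omega) hn ht0 ht1
    (altSumLinear_ne_zero (by omega)) fun b v i j => ?_
  by_cases hij : i = j
  · subst hij
    exact Or.inl fun p q => mul_comm _ _
  refine AnnihilatesPair.proportional_or hk hn.le hnk
    (annihilatesPair_of_polarCoeff_two _ (fun x => ?_) hij)
  rw [← polarCoeff_two_rank_one (L.symm x) b v]
  refine polarCoeff_eq_of_forall hF (fun c => ?_) (by omega)
  rw [← hL (L.symm x + c • fun j => b j • v), L.map_add, L.map_smul, L.apply_symm_apply]
  rfl

end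

theorem stmt_19 {F : Type*} [Field F] {n k : ℕ}
    (hk : 3 ≤ k) (hn : k + 2 ≤ n)
    (hF : (k : Cardinal) < Cardinal.mk F) (hpar : Even (n + k))
    (phi psi : Matrix (Fin n) (Fin k) F → Matrix (Fin n) (Fin k) F)
    (h : ∀ (X Y : Matrix (Fin n) (Fin k) F) (lam : F),
      cullisDet (X + lam • Y) = cullisDet (phi X + lam • psi Y)) :
    ∃ (A : Matrix (Fin n) (Fin n) F) (B : Matrix (Fin k) (Fin k) F),
      (∀ f : Fin k → Fin n, StrictMono f →
        cullisDet (Matrix.of fun (i : Fin n) (j : Fin k) => A i (f j)) * Matrix.det B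
          = (-1 : F) ^ ((∑ t : Fin k, ((f t : ℕ) + 1)) + (∑ t : Fin k, ((t : ℕ) + 1)))) ∧
      (∀ X : Matrix (Fin n) (Fin k) F, phi X = A * X * B) ∧
      (∀ X : Matrix (Fin n) (Fin k) F, psi X = A * X * B) := by
  let f : (Fin k → Fin n → F) → Fin k → Fin n → F :=
    fun x j i => phi (Matrix.of fun i j => x j i) i j
  let g : (Fin k → Fin n → F) → Fin k → Fin n → F :=
    fun x j i => psi (Matrix.of fun i j => x j i) i j
  have hform : ∀ (x y : Fin k → Fin n → F) (c : F),
      cullisForm F n k (x + c • y) = cullisForm F n k (f x + c • g y) := fun x y c => by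
    have := h (Matrix.of fun i j => x j i) (Matrix.of fun i j => y j i) c
    rwa [cullisDet_eq_cullisForm, cullisDet_eq_cullisForm] at this
  obtain ⟨L, hphi, hpsi⟩ :=
    exists_linearEquiv_of_preserves (by omega) (by omega) hpar hF f g hform
  obtain ⟨A, B, hAB⟩ := exists_mul_of_preserves hk (by omega) hpar hF L fun x => by
    have := hform x 0 0
    rw [zero_smul, zero_smul, add_zero, add_zero] at this
    rw [← hphi, this]
  have hL : ∀ (X : Matrix (Fin n) (Fin k) F) i l,
      L (fun j i => X i j) l i = (LinearMap.toMatrix' A * X * B) i l := fun X i l => by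
    rw [hAB, Finset.sum_apply, Matrix.mul_apply]
    refine Finset.sum_congr rfl fun j _ => ?_
    rw [Pi.smul_apply, smul_eq_mul, mul_comm, ← LinearMap.toMatrix'_mulVec]
    rfl
  have hphi' : ∀ X, phi X = LinearMap.toMatrix' A * X * B := fun X => by
    ext i l
    rw [← hL, ← hphi]
    rfl
  refine ⟨LinearMap.toMatrix' A, B, fun f hf => ?_, hphi', fun X => ?_⟩
  · rw [← cullisDet_single hf, ← cullisDet_mul]
    have h0 := h (Matrix.of fun i j => if i = f j then (1 : F) else 0) 0 0
    rw [zero_smul, zero_smul, add_zero, add_zero, hphi'] at h0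
    rw [h0]
    congr 2
    ext i j
    simp [Matrix.mul_apply]
  · ext i l
    rw [← hL, ← hpsi]
    rfl

end
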